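/- Let σ be a primitive, non-erasing, well-marked substitution over 𝔸 = {a,b} whose fixed point ξ is not ultimately periodic, with A·B ≠ B·A and W_0, T as in the context. Then there exists L ∈ ℕ such that every factor W of ξ with |W| ≥ L that is simultaneously left special and right special satisfies W = T(U) for a unique word U. -/

import Mathlib

namespace Subst

/-- `pow A m` is the `m`-fold concatenation `A^m`. -/
def pow (A : List Bool) : ℕ → List Bool
  | 0 => []
  | n + 1 => pow A n ++ A

/-- Membership in the submonoid of `𝔸*` generated by `{A, B}`. -/
inductive GenAB (A B : List Bool) : List Bool → Prop
  | nil : GenAB A B []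
  | appA : ∀ {W}, GenAB A B W → GenAB A B (W ++ A)
  | appB : ∀ {W}, GenAB A B W → GenAB A B (W ++ B)

/-- The extension of a substitution `σ : 𝔸 → 𝔸*` to a monoid morphism of `𝔸*`. -/
def subst (σ : Bool → List Bool) : List Bool → List Bool
  | [] => []
  | c :: w => σ c ++ subst σ w

/-- The factor `ξ[i, i+n)` of the infinite sequence `ξ`. -/
def wordAt (ξ : ℕ → Bool) (i n : ℕ) : List Bool :=
  (List.range n).map fun k => ξ (i + k)

/-- `W` is a factor of the infinite sequence `ξ`. -/
def IsFactor (ξ : ℕ → Bool) (W : List Bool) : Prop :=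
  ∃ i, W = wordAt ξ i W.length

/-- `ξ` is a fixed point of `σ`: for every `n`, `σ(ξ[0,n))` is a prefix of `ξ`. -/
def IsFixedPoint (σ : Bool → List Bool) (ξ : ℕ → Bool) : Prop :=
  ∀ n, subst σ (wordAt ξ 0 n) = wordAt ξ 0 (subst σ (wordAt ξ 0 n)).length

/-- `ξ` is recurrent: every factor occurs at infinitely many positions. -/
def Recurrent (ξ : ℕ → Bool) : Prop :=
  ∀ W, IsFactor ξ W → ∀ N, ∃ i, N ≤ i ∧ W = wordAt ξ i W.length

/-- `ξ` is ultimately periodic. -/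
def UltPeriodic (ξ : ℕ → Bool) : Prop :=
  ∃ p, 1 ≤ p ∧ ∃ N, ∀ n, N ≤ n → ξ (n + p) = ξ n

/-- `σ` is non-erasing: the image of each letter is nonempty. -/
def NonErasing (σ : Bool → List Bool) : Prop := ∀ c, σ c ≠ []

/-- `σ` is well-marked: `σ(c)` begins with the letter `c` for each letter `c`. -/
def WellMarked (σ : Bool → List Bool) : Prop := ∀ c, ∃ t, σ c = c :: t

/-- `σ` is primitive: for some `n ≥ 1`, each letter occurs in `σⁿ(d)` for each letter `d`. -/
def Primitive (σ : Bool → List Bool) : Prop :=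
  ∃ n, 1 ≤ n ∧ ∀ c d : Bool, c ∈ (subst σ)^[n] [d]

/-- `W` is a right special factor of `ξ`: both `Wa` and `Wb` are factors of `ξ`. -/
def RightSpecial (ξ : ℕ → Bool) (W : List Bool) : Prop :=
  ∀ c : Bool, IsFactor ξ (W ++ [c])

/-- `W` is a left special factor of `ξ`: both `aW` and `bW` are factors of `ξ`. -/
def LeftSpecial (ξ : ℕ → Bool) (W : List Bool) : Prop :=
  ∀ c : Bool, IsFactor ξ (c :: W)

/-- A right special factor is strong if all of `aWa, aWb, bWa, bWb` are factors. -/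
def StrongSpecial (ξ : ℕ → Bool) (W : List Bool) : Prop :=
  ∀ c d : Bool, IsFactor ξ (c :: (W ++ [d]))

/-- A right special factor is weak if neither `aW` nor `bW` is right special. -/
def WeakSpecial (ξ : ℕ → Bool) (W : List Bool) : Prop :=
  RightSpecial ξ W ∧ ∀ c : Bool, ¬ RightSpecial ξ (c :: W)

/-- The operator `T(W) = W₀ · σ(W)`. -/
def T (σ : Bool → List Bool) (W0 W : List Bool) : List Bool := W0 ++ subst σ W

/-- Specification of the word `W₀` (the longest common suffix of `A^∞` and `B^∞`)
together with the distinct letters `δ_a, δ_b`:  `δ_c · W₀` is a suffix of some power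
of `σ(c)` for each letter `c`, and `δ_a ≠ δ_b`. -/
def W0Spec (σ : Bool → List Bool) (W0 : List Bool) (δ : Bool → Bool) : Prop :=
  δ false ≠ δ true ∧ ∀ c, ∃ m, 1 ≤ m ∧ (δ c :: W0) <:+ pow (σ c) m

/-- The incidence matrix of `σ`: its columns are the Parikh vectors of `σ(a)` and `σ(b)`. -/
def incMat (σ : Bool → List Bool) : Matrix Bool Bool ℤ :=
  Matrix.of fun c d => ((σ d).count c : ℤ)

end Subst

open Subst

namespace Subst

section Words

theorem length_wordAt (ξ : ℕ → Bool) (i n : ℕ) : (wordAt ξ i n).length = n := by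
  simp [wordAt]

theorem wordAt_add (ξ : ℕ → Bool) (i m n : ℕ) :
    wordAt ξ i (m + n) = wordAt ξ i m ++ wordAt ξ (i + m) n := by
  simp [wordAt, List.range_add, Function.comp_def, add_assoc]

theorem wordAt_succ (ξ : ℕ → Bool) (i n : ℕ) :
    wordAt ξ i (n + 1) = wordAt ξ i n ++ [ξ (i + n)] := by
  simp [wordAt, List.range_succ]

theorem getElem?_wordAt (ξ : ℕ → Bool) (i : ℕ) {n k : ℕ} (hk : k < n) :
    (wordAt ξ i n)[k]? = some (ξ (i + k)) := by
  simp [wordAt, hk]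

theorem wordAt_eq_iff (ξ : ℕ → Bool) (i j n : ℕ) :
    wordAt ξ i n = wordAt ξ j n ↔ ∀ k < n, ξ (i + k) = ξ (j + k) := by
  simp [wordAt]

/-- A decomposition of a factor into two words locates both words. -/
theorem eq_wordAt_of_append {ξ : ℕ → Bool} {i n : ℕ} {V W : List Bool}
    (h : V ++ W = wordAt ξ i n) :
    V = wordAt ξ i V.length ∧ W = wordAt ξ (i + V.length) W.length := by
  have hn : n = V.length + W.length := by
    simpa [length_wordAt] using (congrArg List.length h).symm
  rw [hn, wordAt_add] at h
  exact List.append_inj h (length_wordAt _ _ _).symm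

theorem eq_wordAt_of_suffix {ξ : ℕ → Bool} {n : ℕ} {W : List Bool}
    (h : W <:+ wordAt ξ 0 n) : W.length ≤ n ∧ W = wordAt ξ (n - W.length) W.length := by
  obtain ⟨V, hV⟩ := h
  have hn : V.length + W.length = n := by
    simpa [length_wordAt] using congrArg List.length hV
  have h2 := (eq_wordAt_of_append hV).2
  refine ⟨by omega, ?_⟩
  rwa [show n - W.length = 0 + V.length by omega]

theorem exists_eq_wordAt_of_infix {ξ : ℕ → Bool} {i n : ℕ} {W : List Bool}
    (h : W <:+: wordAt ξ i n) :
    ∃ j, i ≤ j ∧ j + W.length ≤ i + n ∧ W = wordAt ξ j W.length := by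
  obtain ⟨V, V', hV⟩ := h
  have hn : V.length + W.length + V'.length = n := by
    simpa [length_wordAt, add_assoc] using congrArg List.length hV
  exact ⟨i + V.length, by omega, by omega,
    (eq_wordAt_of_append (eq_wordAt_of_append hV).1).2⟩

end Words

section Morphism

variable {σ : Bool → List Bool}

theorem subst_append (σ : Bool → List Bool) (V W : List Bool) :
    subst σ (V ++ W) = subst σ V ++ subst σ W := by
  induction V with
  | nil => rfl
  | cons c V ih => simp [subst, ih]

theorem subst_singleton (σ : Bool → List Bool) (c : Bool) : subst σ [c] = σ c := by
  simp [subst]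

theorem subst_iterate_append (σ : Bool → List Bool) (k : ℕ) (V W : List Bool) :
    (subst σ)^[k] (V ++ W) = (subst σ)^[k] V ++ (subst σ)^[k] W := by
  induction k generalizing V W with
  | zero => rfl
  | succ k ih => simp [subst_append, ih]

/-- The `k`-th power of a substitution. -/
def iter (σ : Bool → List Bool) (k : ℕ) (c : Bool) : List Bool := (subst σ)^[k] [c]

theorem subst_iter (σ : Bool → List Bool) (k : ℕ) (W : List Bool) :
    subst (iter σ k) W = (subst σ)^[k] W := by
  induction W with
  | nil =>
    have h := congrArg List.length (subst_iterate_append σ k [] [])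
    rw [List.append_nil, List.length_append] at h
    exact (List.length_eq_zero_iff.mp (by omega)).symm
  | cons c W ih =>
    rw [subst, ih, iter, ← subst_iterate_append, List.singleton_append]

theorem subst_injective (hwm : WellMarked σ) : Function.Injective (subst σ) := by
  intro V
  induction V with
  | nil =>
    intro W h
    cases W with
    | nil => rfl
    | cons d W =>
      obtain ⟨t, ht⟩ := hwm d
      simp [subst, ht] at h
  | cons c V ih =>
    intro W h
    obtain ⟨s, hs⟩ := hwm c
    cases W with
    | nil => simp [subst, hs] at h
    | cons d W =>
      obtain ⟨t, ht⟩ := hwm d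
      have hcd : c = d := by
        simp only [subst, hs, ht, List.cons_append, List.cons.injEq] at h
        exact h.1
      subst hcd
      simp only [subst, List.append_cancel_left_eq] at h
      rw [ih h]

theorem two_mul_length_le {k : ℕ} (hk : ∀ c d : Bool, c ∈ (subst σ)^[k] [d]) (W : List Bool) :
    2 * W.length ≤ ((subst σ)^[k] W).length := by
  rw [← subst_iter]
  induction W with
  | nil => simp
  | cons d W ih =>
    have h2 : 2 ≤ (iter σ k d).length := by
      have ht : true ∈ iter σ k d := hk true d
      have hf : false ∈ iter σ k d := hk false d
      match h : iter σ k d with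
      | [] => simp [h] at ht
      | [c] => cases c <;> simp [h] at ht hf
      | _ :: _ :: _ => simp
    simp only [subst, List.length_append, List.length_cons]
    omega

theorem two_pow_mul_length_le {k : ℕ} (hk : ∀ c d : Bool, c ∈ (subst σ)^[k] [d]) (n : ℕ)
    (W : List Bool) : 2 ^ n * W.length ≤ ((subst σ)^[k * n] W).length := by
  rw [Function.iterate_mul]
  induction n with
  | zero => simp
  | succ n ih =>
    rw [Function.iterate_succ_apply']
    have := two_mul_length_le hk (((subst σ)^[k])^[n] W)
    rw [pow_succ]
    linarith

theorem subst_iterate_singleton_infix {c : Bool} {W : List Bool} (h : c ∈ W) (k : ℕ) :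
    (subst σ)^[k] [c] <:+: (subst σ)^[k] W := by
  obtain ⟨s, t, rfl⟩ := List.append_of_mem h
  refine ⟨(subst σ)^[k] s, (subst σ)^[k] t, ?_⟩
  simp [← subst_iterate_append]

end Morphism

section FixedPoint

variable {σ : Bool → List Bool} {ξ : ℕ → Bool}

theorem IsFixedPoint.subst_prefix (hfix : IsFixedPoint σ ξ) {W : List Bool}
    (h : W = wordAt ξ 0 W.length) : subst σ W = wordAt ξ 0 (subst σ W).length := by
  have := hfix W.length
  rwa [← h] at this

theorem IsFixedPoint.subst_iterate_prefix (hfix : IsFixedPoint σ ξ) (k : ℕ) {W : List Bool}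
    (h : W = wordAt ξ 0 W.length) :
    (subst σ)^[k] W = wordAt ξ 0 ((subst σ)^[k] W).length := by
  induction k with
  | zero => exact h
  | succ k ih =>
    rw [Function.iterate_succ_apply']
    exact hfix.subst_prefix ih

theorem IsFixedPoint.iter (hfix : IsFixedPoint σ ξ) (k : ℕ) :
    IsFixedPoint (Subst.iter σ k) ξ := by
  intro n
  rw [subst_iter]
  exact hfix.subst_iterate_prefix k (by rw [length_wordAt])

/-- The position in `ξ = σ(ξ)` at which the image of the `n`-th letter begins. -/
def cutPos (σ : Bool → List Bool) (ξ : ℕ → Bool) (n : ℕ) : ℕ :=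
  (subst σ (wordAt ξ 0 n)).length

/-- `p` is a position at which the image of some letter of `ξ` begins. -/
def IsCut (σ : Bool → List Bool) (ξ : ℕ → Bool) (p : ℕ) : Prop := ∃ n, cutPos σ ξ n = p

theorem cutPos_succ (σ : Bool → List Bool) (ξ : ℕ → Bool) (n : ℕ) :
    cutPos σ ξ (n + 1) = cutPos σ ξ n + (σ (ξ n)).length := by
  simp [cutPos, wordAt_succ, subst_append, subst_singleton]

theorem cutPos_zero (σ : Bool → List Bool) (ξ : ℕ → Bool) : cutPos σ ξ 0 = 0 := by
  simp [cutPos, wordAt, subst]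

theorem IsFixedPoint.wordAt_cutPos (hfix : IsFixedPoint σ ξ) (n : ℕ) :
    σ (ξ n) = wordAt ξ (cutPos σ ξ n) (σ (ξ n)).length := by
  have h := hfix (n + 1)
  rw [wordAt_succ, subst_append, zero_add, subst_singleton] at h
  simpa [cutPos] using (eq_wordAt_of_append h).2

theorem cutPos_strictMono (hne : NonErasing σ) (ξ : ℕ → Bool) : StrictMono (cutPos σ ξ) := by
  refine strictMono_nat_of_lt_succ fun n => ?_
  have := List.length_pos_iff.mpr (hne (ξ n))
  rw [cutPos_succ]
  omega

/-- The index of the letter of `ξ` whose image covers the position `p`. -/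
def blockIndex (σ : Bool → List Bool) (ξ : ℕ → Bool) (p : ℕ) : ℕ :=
  Nat.findGreatest (fun n => cutPos σ ξ n ≤ p) p

theorem cutPos_blockIndex_le (σ : Bool → List Bool) (ξ : ℕ → Bool) (p : ℕ) :
    cutPos σ ξ (blockIndex σ ξ p) ≤ p :=
  Nat.findGreatest_spec (P := fun n => cutPos σ ξ n ≤ p) (Nat.zero_le p)
    (by simp [cutPos_zero])

theorem lt_cutPos_blockIndex_succ (hne : NonErasing σ) (ξ : ℕ → Bool) (p : ℕ) :
    p < cutPos σ ξ (blockIndex σ ξ p + 1) := by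
  by_contra! h
  have h1 := (cutPos_strictMono hne ξ).le_apply (x := blockIndex σ ξ p + 1)
  have h2 : blockIndex σ ξ p + 1 ≤ blockIndex σ ξ p :=
    Nat.le_findGreatest (P := fun n => cutPos σ ξ n ≤ p) (h1.trans h) h
  omega

theorem blockIndex_eq (hne : NonErasing σ) {p n : ℕ} (h1 : cutPos σ ξ n ≤ p)
    (h2 : p < cutPos σ ξ (n + 1)) : blockIndex σ ξ p = n := by
  have hm := cutPos_strictMono hne ξ
  have h3 := cutPos_blockIndex_le σ ξ p
  have h4 := lt_cutPos_blockIndex_succ hne ξ p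
  have h5 := hm.lt_iff_lt.mp (h3.trans_lt h2)
  have h6 := hm.lt_iff_lt.mp (h1.trans_lt h4)
  omega

end FixedPoint

section Recurrence

variable {σ : Bool → List Bool} {ξ : ℕ → Bool}

/-- Uniform recurrence: each prefix of `ξ` occurs in every sufficiently long window. -/
theorem exists_prefix_occurrence (hprim : Primitive σ) (hfix : IsFixedPoint σ ξ) (n : ℕ) :
    ∃ M, ∀ i, ∃ j, i ≤ j ∧ j + n ≤ i + M ∧ ∀ k < n, ξ (j + k) = ξ k := by
  obtain ⟨N, -, hN⟩ := hprim
  set V := (subst σ)^[N * n] [ξ 0] with hV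
  have hVn : n < V.length := by
    have h1 := two_pow_mul_length_le hN n [ξ 0]
    rw [List.length_singleton, mul_one, ← hV] at h1
    exact Nat.lt_two_pow_self.trans_le h1
  have hVp : V = wordAt ξ 0 V.length :=
    hfix.subst_iterate_prefix _ (by simp [wordAt])
  set ρ := iter σ (N * n + N) with hρ
  have hinf : ∀ d, V <:+: ρ d := fun d => by
    rw [hρ, iter, Function.iterate_add_apply]
    exact subst_iterate_singleton_infix (hN _ _) _
  have hρfix : IsFixedPoint ρ ξ := hfix.iter _
  have hρne : NonErasing ρ := fun d hd => by
    have := (hinf d).length_le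
    rw [hd, List.length_nil] at this
    omega
  set M := (ρ true).length + (ρ false).length with hM
  have hρM : ∀ d, (ρ d).length ≤ M := fun d => by cases d <;> omega
  refine ⟨M + M, fun i => ?_⟩
  set b := blockIndex ρ ξ i with hb
  have h1 : cutPos ρ ξ b ≤ i := cutPos_blockIndex_le ρ ξ i
  have h2 : i < cutPos ρ ξ (b + 1) := lt_cutPos_blockIndex_succ hρne ξ i
  have h3 := hinf (ξ (b + 1))
  rw [hρfix.wordAt_cutPos (b + 1)] at h3
  obtain ⟨j, hj1, hj2, hj3⟩ := exists_eq_wordAt_of_infix h3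
  have h4 := cutPos_succ ρ ξ b
  have h5 := hρM (ξ b)
  have h6 := hρM (ξ (b + 1))
  refine ⟨j, by omega, by omega, fun k hk => ?_⟩
  have := (wordAt_eq_iff ξ j 0 V.length).mp (hj3.symm.trans hVp) k (hk.trans hVn)
  rwa [zero_add] at this

theorem exists_late_occurrence (hprim : Primitive σ) (hfix : IsFixedPoint σ ξ) {W : List Bool}
    (h : IsFactor ξ W) (N : ℕ) : ∃ i, N ≤ i ∧ W = wordAt ξ i W.length := by
  obtain ⟨i, hi⟩ := h
  obtain ⟨M, hM⟩ := exists_prefix_occurrence hprim hfix (i + W.length)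
  obtain ⟨j, hj, -, hk⟩ := hM N
  refine ⟨j + i, by omega, hi.trans ?_⟩
  rw [wordAt_eq_iff]
  intro k hkW
  rw [add_assoc, hk (i + k) (by omega)]

/-- Long windows of `ξ` do not admit the period `p`. -/
theorem exists_period_bound (hprim : Primitive σ) (hfix : IsFixedPoint σ ξ)
    (hnp : ¬ UltPeriodic ξ) {p : ℕ} (hp : 1 ≤ p) :
    ∃ R, ∀ i, ∃ k < R, ξ (i + k + p) ≠ ξ (i + k) := by
  have h : ∃ n, ξ (n + p) ≠ ξ n := by
    by_contra! h
    exact hnp ⟨p, hp, 0, fun n _ => h n⟩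
  obtain ⟨n, hn⟩ := h
  obtain ⟨M, hM⟩ := exists_prefix_occurrence hprim hfix (n + p + 1)
  refine ⟨M, fun i => ?_⟩
  obtain ⟨j, hij, hjM, hj⟩ := hM i
  refine ⟨j - i + n, by omega, ?_⟩
  rw [show i + (j - i + n) = j + n by omega, hj n (by omega), add_assoc, hj _ (by omega)]
  exact hn

theorem exists_uniform_period_bound (hprim : Primitive σ) (hfix : IsFixedPoint σ ξ)
    (hnp : ¬ UltPeriodic ξ) (P : ℕ) :
    ∃ R, ∀ p, 1 ≤ p → p ≤ P → ∀ i, ∃ k < R, ξ (i + k + p) ≠ ξ (i + k) := by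
  induction P with
  | zero => exact ⟨0, fun p h1 h2 => by omega⟩
  | succ P ih =>
    obtain ⟨R, hR⟩ := ih
    obtain ⟨R', hR'⟩ := exists_period_bound hprim hfix hnp (Nat.succ_pos P)
    refine ⟨max R R', fun p h1 h2 i => ?_⟩
    rcases h2.lt_or_eq with h | rfl
    · obtain ⟨k, hk, h⟩ := hR p h1 (by omega) i
      exact ⟨k, lt_max_of_lt_left hk, h⟩
    · obtain ⟨k, hk, h⟩ := hR' i
      exact ⟨k, lt_max_of_lt_right hk, h⟩

end Recurrence

section Synchronization

variable {σ : Bool → List Bool} {ξ : ℕ → Bool}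

/-- The letter whose image covers the position `p`, with the offset of `p` in that image. -/
def state (σ : Bool → List Bool) (ξ : ℕ → Bool) (p : ℕ) : Bool × ℕ :=
  (ξ (blockIndex σ ξ p), p - cutPos σ ξ (blockIndex σ ξ p))

theorem state_snd_lt (hne : NonErasing σ) (ξ : ℕ → Bool) (p : ℕ) :
    (state σ ξ p).2 < (σ (state σ ξ p).1).length := by
  have h1 := cutPos_blockIndex_le σ ξ p
  have h2 := lt_cutPos_blockIndex_succ hne ξ p
  rw [cutPos_succ] at h2
  simp only [state]
  omega

theorem getElem?_state (hne : NonErasing σ) (hfix : IsFixedPoint σ ξ) (p : ℕ) :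
    (σ (state σ ξ p).1)[(state σ ξ p).2]? = some (ξ p) := by
  have h1 := cutPos_blockIndex_le σ ξ p
  have h2 := state_snd_lt hne ξ p
  have h3 := hfix.wordAt_cutPos (blockIndex σ ξ p)
  simp only [state] at h2 ⊢
  rw [h3, getElem?_wordAt _ _ h2]
  congr 2
  omega

theorem apply_cutPos (hwm : WellMarked σ) (hfix : IsFixedPoint σ ξ) (n : ℕ) :
    ξ (cutPos σ ξ n) = ξ n := by
  obtain ⟨t, ht⟩ := hwm (ξ n)
  have h := getElem?_wordAt ξ (cutPos σ ξ n) (n := (σ (ξ n)).length) (k := 0) (by simp [ht])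
  rw [← hfix.wordAt_cutPos n, ht] at h
  simpa using h.symm

theorem state_of_isCut (hne : NonErasing σ) (hwm : WellMarked σ) (hfix : IsFixedPoint σ ξ)
    {p : ℕ} (h : IsCut σ ξ p) : state σ ξ p = (ξ p, 0) := by
  obtain ⟨n, rfl⟩ := h
  have h1 : blockIndex σ ξ (cutPos σ ξ n) = n :=
    blockIndex_eq hne le_rfl (cutPos_strictMono hne ξ (Nat.lt_succ_self n))
  simp [state, h1, apply_cutPos hwm hfix]

theorem isCut_succ_iff (hne : NonErasing σ) (ξ : ℕ → Bool) (p : ℕ) :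
    IsCut σ ξ (p + 1) ↔ ¬ (state σ ξ p).2 + 1 < (σ (state σ ξ p).1).length := by
  have h1 := cutPos_blockIndex_le σ ξ p
  have h2 := lt_cutPos_blockIndex_succ hne ξ p
  have h3 := cutPos_succ σ ξ (blockIndex σ ξ p)
  have hm := cutPos_strictMono hne ξ
  simp only [state]
  constructor
  · rintro ⟨n, hn⟩ h
    have h4 : blockIndex σ ξ p < n := hm.lt_iff_lt.mp (by omega)
    have h5 : n < blockIndex σ ξ p + 1 := hm.lt_iff_lt.mp (by omega)
    omega
  · intro h
    exact ⟨blockIndex σ ξ p + 1, by omega⟩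

theorem state_succ (hne : NonErasing σ) (hwm : WellMarked σ) (hfix : IsFixedPoint σ ξ) (p : ℕ) :
    state σ ξ (p + 1) =
      if (state σ ξ p).2 + 1 < (σ (state σ ξ p).1).length then
        ((state σ ξ p).1, (state σ ξ p).2 + 1) else (ξ (p + 1), 0) := by
  split_ifs with h
  · have h1 := cutPos_blockIndex_le σ ξ p
    have h3 := cutPos_succ σ ξ (blockIndex σ ξ p)
    simp only [state] at h
    have h4 : blockIndex σ ξ (p + 1) = blockIndex σ ξ p :=
      blockIndex_eq hne (by omega) (by omega)
    simp only [state, h4, Prod.mk.injEq, true_and]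
    omega
  · exact state_of_isCut hne hwm hfix ((isCut_succ_iff hne ξ p).mpr h)

/-- Inside an image, the next letter is determined by the state. -/
theorem apply_succ_eq_of_state_eq (hne : NonErasing σ) (hwm : WellMarked σ)
    (hfix : IsFixedPoint σ ξ) {p q : ℕ} (h : state σ ξ p = state σ ξ q)
    (hp : ¬ IsCut σ ξ (p + 1)) : ξ (p + 1) = ξ (q + 1) := by
  rw [isCut_succ_iff hne, not_not] at hp
  have h1 := state_succ hne hwm hfix p
  have h2 := state_succ hne hwm hfix q
  rw [if_pos hp] at h1
  rw [← h, if_pos hp, ← h1] at h2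
  have h3 := getElem?_state hne hfix (p + 1)
  rw [← h2, getElem?_state hne hfix (q + 1)] at h3
  exact (Option.some_injective _ h3).symm

theorem state_succ_eq_of_state_eq (hne : NonErasing σ) (hwm : WellMarked σ)
    (hfix : IsFixedPoint σ ξ) {p q : ℕ} (h : state σ ξ p = state σ ξ q)
    (hpq : ξ (p + 1) = ξ (q + 1)) : state σ ξ (p + 1) = state σ ξ (q + 1) := by
  rw [state_succ hne hwm hfix, state_succ hne hwm hfix q, h, hpq]

theorem isCut_succ_iff_of_state_eq (hne : NonErasing σ) {p q : ℕ}
    (h : state σ ξ p = state σ ξ q) : IsCut σ ξ (p + 1) ↔ IsCut σ ξ (q + 1) := by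
  rw [isCut_succ_iff hne, isCut_succ_iff hne, h]

/-- Past a common cut, two occurrences of the same word are parsed in the same way. -/
theorem state_eq_of_common_cut (hne : NonErasing σ) (hwm : WellMarked σ)
    (hfix : IsFixedPoint σ ξ) {i j ℓ t : ℕ} (heq : ∀ s < ℓ, ξ (i + s) = ξ (j + s))
    (hi : IsCut σ ξ (i + t)) (hj : IsCut σ ξ (j + t)) {u : ℕ} (htu : t ≤ u) (hu : u < ℓ) :
    state σ ξ (i + u) = state σ ξ (j + u) := by
  induction u, htu using Nat.le_induction with
  | base => rw [state_of_isCut hne hwm hfix hi, state_of_isCut hne hwm hfix hj, heq _ hu]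
  | succ u _ ih =>
    exact state_succ_eq_of_state_eq hne hwm hfix (ih (by omega)) (heq (u + 1) hu)

/-- Two disjoint parsings of the same word evolve deterministically. -/
theorem state_pair_succ_eq (hne : NonErasing σ) (hwm : WellMarked σ) (hfix : IsFixedPoint σ ξ)
    {i j s t : ℕ} (h1 : state σ ξ (i + s) = state σ ξ (i + t))
    (h2 : state σ ξ (j + s) = state σ ξ (j + t))
    (hs : ξ (i + (s + 1)) = ξ (j + (s + 1))) (ht : ξ (i + (t + 1)) = ξ (j + (t + 1)))
    (hcut : ¬ (IsCut σ ξ (i + (s + 1)) ∧ IsCut σ ξ (j + (s + 1)))) :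
    state σ ξ (i + (s + 1)) = state σ ξ (i + (t + 1)) ∧
      state σ ξ (j + (s + 1)) = state σ ξ (j + (t + 1)) := by
  simp only [← add_assoc] at *
  have hletter : ξ (i + s + 1) = ξ (i + t + 1) := by
    by_cases hc : IsCut σ ξ (i + s + 1)
    · rw [hs, ht]
      exact apply_succ_eq_of_state_eq hne hwm hfix h2 fun h => hcut ⟨hc, h⟩
    · exact apply_succ_eq_of_state_eq hne hwm hfix h1 hc
  exact ⟨state_succ_eq_of_state_eq hne hwm hfix h1 hletter,
    state_succ_eq_of_state_eq hne hwm hfix h2 (by rw [← hs, ← ht, hletter])⟩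

theorem exists_common_cut (hne : NonErasing σ) (hwm : WellMarked σ) (hprim : Primitive σ)
    (hfix : IsFixedPoint σ ξ) (hnp : ¬ UltPeriodic ξ) :
    ∃ L, ∀ i j, (∀ s < L, ξ (i + s) = ξ (j + s)) →
      ∃ t < L, IsCut σ ξ (i + t) ∧ IsCut σ ξ (j + t) := by
  set M := (σ true).length + (σ false).length with hM
  have hst : ∀ p, (state σ ξ p).2 < M := fun p => by
    have h := state_snd_lt hne ξ p
    have h' : ∀ c, (σ c).length ≤ M := fun c => by cases c <;> omega
    exact h.trans_le (h' _)
  set P := Fintype.card ((Bool × Fin M) × (Bool × Fin M)) with hP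
  obtain ⟨R, hR⟩ := exists_uniform_period_bound hprim hfix hnp P
  refine ⟨P + P + R + 1, fun i j heq => ?_⟩
  by_contra! hno
  let code (p : ℕ) : Bool × Fin M := ((state σ ξ p).1, ⟨(state σ ξ p).2, hst p⟩)
  have hcode : ∀ {p q}, code p = code q → state σ ξ p = state σ ξ q := fun {p q} h => by
    simp only [code, Prod.mk.injEq, Fin.mk.injEq] at h
    exact Prod.ext h.1 h.2
  obtain ⟨s, t, hst', hcst⟩ := Fintype.exists_ne_map_eq_of_card_lt
    (fun t : Fin (P + 1) => (code (i + t), code (j + t))) (by simp [hP])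
  wlog hlt : s < t generalizing s t
  · exact this t s hst'.symm hcst.symm (lt_of_le_of_ne (not_lt.mp hlt) hst'.symm)
  have hlt' : (s : ℕ) < t := hlt
  have htP := t.isLt
  obtain ⟨h1, h2⟩ := Prod.mk.inj hcst
  have hper : ∀ k, t + k < P + P + R + 1 →
      state σ ξ (i + (s + k)) = state σ ξ (i + (t + k)) ∧
        state σ ξ (j + (s + k)) = state σ ξ (j + (t + k)) := by
    intro k
    induction k with
    | zero => exact fun _ => ⟨hcode h1, hcode h2⟩
    | succ k ih =>
      intro hk
      obtain ⟨g1, g2⟩ := ih (by omega)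
      exact state_pair_succ_eq hne hwm hfix g1 g2 (heq (s + k + 1) (by omega)) (heq (t + k + 1) hk)
        fun h => hno (s + k + 1) (by omega) h.1 h.2
  obtain ⟨k, hk, hkne⟩ := hR (t - s) (by omega) (by omega) (i + s)
  have h3 := (hper k (by omega)).1
  have h4 := getElem?_state hne hfix (i + (s + k))
  rw [h3, getElem?_state hne hfix (i + (t + k))] at h4
  refine hkne ?_
  rw [show i + ↑s + k + (↑t - ↑s) = i + (t + k) by omega, add_assoc i]
  exact Option.some_injective _ h4

end Synchronization

section CommonSuffix

variable {σ : Bool → List Bool} {ξ : ℕ → Bool} {W0 : List Bool} {δ : Bool → Bool}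

theorem W0Spec.suffix_append (hne : NonErasing σ) (hW0 : W0Spec σ W0 δ) (c : Bool) :
    (δ c :: W0) <:+ W0 ++ σ c := by
  obtain ⟨m, -, hm⟩ := hW0.2 c
  have h1 : W0 ++ σ c <:+ pow (σ c) (m + 1) := by
    obtain ⟨V, hV⟩ := (List.suffix_cons (δ c) W0).trans hm
    exact ⟨V, by rw [pow, ← hV, List.append_assoc]⟩
  have h2 : (δ c :: W0) <:+ pow (σ c) (m + 1) := by
    have h : ∀ m, pow (σ c) (m + 1) = σ c ++ pow (σ c) m := fun m => by
      induction m with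
      | zero => simp [pow]
      | succ m ih => rw [pow, ih, List.append_assoc, ← ih, pow]
    rw [h]
    exact hm.trans (List.suffix_append _ _)
  refine List.suffix_of_suffix_length_le h2 h1 ?_
  have := List.length_pos_iff.mpr (hne c)
  simp only [List.length_cons, List.length_append]
  omega

theorem W0Spec.suffix_append_subst (hne : NonErasing σ) (hW0 : W0Spec σ W0 δ) (X : List Bool) :
    W0 <:+ W0 ++ subst σ X := by
  induction X using List.reverseRecOn with
  | nil => simp [subst]
  | append_singleton X c ih =>
    rw [subst_append, subst_singleton, ← List.append_assoc]
    obtain ⟨V, hV⟩ := ih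
    rw [← hV, List.append_assoc]
    exact ((List.suffix_cons _ _).trans (hW0.suffix_append hne c)).trans (List.suffix_append _ _)

theorem W0Spec.suffix_wordAt (hne : NonErasing σ) (hW0 : W0Spec σ W0 δ)
    (hfix : IsFixedPoint σ ξ) {n : ℕ} (hn : W0.length ≤ cutPos σ ξ n) :
    (δ (ξ n) :: W0) <:+ wordAt ξ 0 (cutPos σ ξ (n + 1)) := by
  have h1 : W0 <:+ subst σ (wordAt ξ 0 n) :=
    List.suffix_of_suffix_length_le (hW0.suffix_append_subst hne _)
      (List.suffix_append _ _) hn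
  have h2 := hfix (n + 1)
  rw [cutPos, ← h2, wordAt_succ, subst_append, subst_singleton, zero_add]
  obtain ⟨V, hV⟩ := h1
  rw [← hV, List.append_assoc]
  exact (hW0.suffix_append hne _).trans (List.suffix_append _ _)

theorem W0Spec.injective (hW0 : W0Spec σ W0 δ) {c d : Bool} (h : c ≠ d) : δ c ≠ δ d := by
  have := hW0.1
  cases c <;> cases d <;> simp_all [eq_comm]

/-- A word that ends at a cut in two occurrences preceded by distinct letters lies in the
image of `T`. -/
theorem exists_eq_T (hne : NonErasing σ) (hW0 : W0Spec σ W0 δ) (hfix : IsFixedPoint σ ξ)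
    {x y : ℕ} (hx : W0.length + (σ true).length + (σ false).length ≤ x)
    (hy : W0.length + (σ true).length + (σ false).length ≤ y)
    (hxy : ξ x ≠ ξ y) (e : ℕ) (heq : ∀ s < e, ξ (x + 1 + s) = ξ (y + 1 + s))
    (hcx : IsCut σ ξ (x + 1 + e)) (hcy : IsCut σ ξ (y + 1 + e)) :
    ∃ U, wordAt ξ (x + 1) e = T σ W0 U := by
  induction e using Nat.strong_induction_on with
  | _ e ih =>
  have hlen : ∀ c, (σ c).length ≤ (σ true).length + (σ false).length := fun c => by
    cases c <;> omega
  obtain ⟨m, hm⟩ : ∃ m, cutPos σ ξ (m + 1) = x + 1 + e := by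
    obtain ⟨m, hm⟩ := hcx
    cases m with
    | zero => rw [cutPos_zero] at hm; omega
    | succ m => exact ⟨m, hm⟩
  obtain ⟨n, hn⟩ : ∃ n, cutPos σ ξ (n + 1) = y + 1 + e := by
    obtain ⟨n, hn⟩ := hcy
    cases n with
    | zero => rw [cutPos_zero] at hn; omega
    | succ n => exact ⟨n, hn⟩
  have hm' := cutPos_succ σ ξ m
  have hn' := cutPos_succ σ ξ n
  have hlm := hlen (ξ m)
  have hln := hlen (ξ n)
  by_cases hc : ξ m = ξ n
  · have hw : wordAt ξ (cutPos σ ξ m) (σ (ξ m)).length =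
        wordAt ξ (cutPos σ ξ n) (σ (ξ m)).length := by
      rw [← hfix.wordAt_cutPos m, hc, ← hfix.wordAt_cutPos n]
    rw [wordAt_eq_iff] at hw
    rw [← hc] at hn' hln
    by_cases hk : (σ (ξ m)).length ≤ e
    · have hpos := List.length_pos_iff.mpr (hne (ξ m))
      obtain ⟨U, hU⟩ := ih (e - (σ (ξ m)).length) (by omega)
        (fun s hs => heq s (by omega)) ⟨m, by omega⟩ ⟨n, by omega⟩
      refine ⟨U ++ [ξ m], ?_⟩
      rw [T, subst_append, subst_singleton, ← List.append_assoc, ← T, ← hU,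
        hfix.wordAt_cutPos m, length_wordAt,
        show cutPos σ ξ m = x + 1 + (e - (σ (ξ m)).length) by omega, ← wordAt_add]
      congr 1
      omega
    · have := hw ((σ (ξ m)).length - e - 1) (by omega)
      rw [show cutPos σ ξ m + ((σ (ξ m)).length - e - 1) = x by omega,
        show cutPos σ ξ n + ((σ (ξ m)).length - e - 1) = y by omega] at this
      exact absurd this hxy
  · have sx := eq_wordAt_of_suffix (hW0.suffix_wordAt hne hfix (n := m) (by omega))
    have sy := eq_wordAt_of_suffix (hW0.suffix_wordAt hne hfix (n := n) (by omega))
    rw [hm, List.length_cons] at sx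
    rw [hn, List.length_cons] at sy
    have letter_x : ∀ k < W0.length + 1,
        (δ (ξ m) :: W0)[k]? = some (ξ (x + 1 + e - (W0.length + 1) + k)) := fun k hk => by
      rw [sx.2, getElem?_wordAt _ _ hk]
    have letter_y : ∀ k < W0.length + 1,
        (δ (ξ n) :: W0)[k]? = some (ξ (y + 1 + e - (W0.length + 1) + k)) := fun k hk => by
      rw [sy.2, getElem?_wordAt _ _ hk]
    have hδ := hW0.injective hc
    rcases lt_trichotomy e W0.length with h | h | h
    · have h1 := letter_x (W0.length - e) (by omega)
      have h2 := letter_y (W0.length - e) (by omega)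
      rw [show W0.length - e = (W0.length - e - 1) + 1 by omega, List.getElem?_cons_succ] at h1 h2
      rw [h2, show x + 1 + e - (W0.length + 1) + (W0.length - e - 1 + 1) = x by omega,
        show y + 1 + e - (W0.length + 1) + (W0.length - e - 1 + 1) = y by omega] at h1
      exact absurd (Option.some_injective _ h1).symm hxy
    · refine ⟨[], ?_⟩
      have h1 := sx.2
      rw [show x + 1 + e - (W0.length + 1) = x by omega, add_comm W0.length 1, wordAt_add] at h1
      have h2 := (List.append_inj (s₁ := [δ (ξ m)]) h1 (by simp [length_wordAt])).2
      simp only [T, subst, List.append_nil]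
      rw [h, ← h2]
    · have h1 := letter_x 0 (by omega)
      have h2 := letter_y 0 (by omega)
      have h3 := heq (e - (W0.length + 1)) (by omega)
      rw [show x + 1 + (e - (W0.length + 1)) = x + 1 + e - (W0.length + 1) by omega,
        show y + 1 + (e - (W0.length + 1)) = y + 1 + e - (W0.length + 1) by omega] at h3
      simp only [List.getElem?_cons_zero, Option.some.injEq, add_zero] at h1 h2
      exact absurd (by rw [h1, h2, h3]) hδ

end CommonSuffix

end Subst

/-- There exists `L` such that every bispecial factor `W` of `ξ` with
`|W| ≥ L` equals `T(U)` for a unique word `U`. -/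
theorem statement7 (σ : Bool → List Bool) (hne : NonErasing σ)
    (hwm : WellMarked σ) (hprim : Primitive σ)
    (hAB : σ false ++ σ true ≠ σ true ++ σ false)
    (W0 : List Bool) (δ : Bool → Bool) (hW0 : W0Spec σ W0 δ)
    (ξ : ℕ → Bool) (hfix : IsFixedPoint σ ξ) (hnp : ¬ UltPeriodic ξ) :
    ∃ L : ℕ, ∀ W, IsFactor ξ W → L ≤ W.length →
      LeftSpecial ξ W → RightSpecial ξ W →
      ∃! U : List Bool, W = T σ W0 U := by
  obtain ⟨L, hL⟩ := exists_common_cut hne hwm hprim hfix hnp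
  refine ⟨L + 1, fun W _ hWL hleft hright => ?_⟩
  have hleft' : ∀ c, ∃ x, W0.length + (σ true).length + (σ false).length ≤ x ∧ ξ x = c ∧
      W = wordAt ξ (x + 1) W.length := fun c => by
    obtain ⟨x, hx, h⟩ := exists_late_occurrence hprim hfix (hleft c)
      (W0.length + (σ true).length + (σ false).length)
    rw [List.length_cons, add_comm W.length 1, wordAt_add] at h
    obtain ⟨h1, h2⟩ := List.append_inj (s₁ := [c]) h (by simp [length_wordAt])
    exact ⟨x, hx, by simpa [wordAt] using h1.symm, h2⟩
  have hright' : ∀ c, ∃ r, W = wordAt ξ r W.length ∧ ξ (r + W.length) = c := fun c => by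
    obtain ⟨r, hr⟩ := hright c
    rw [List.length_append, List.length_singleton, wordAt_succ] at hr
    obtain ⟨h1, h2⟩ := List.append_inj hr (length_wordAt _ _ _).symm
    exact ⟨r, h1, by simpa using h2.symm⟩
  have hagree : ∀ {i j}, W = wordAt ξ i W.length → W = wordAt ξ j W.length →
      ∀ s < W.length, ξ (i + s) = ξ (j + s) := fun {i j} hi hj =>
    (wordAt_eq_iff ξ i j _).mp (hi.symm.trans hj)
  have hsync : ∀ {i j}, W = wordAt ξ i W.length → W = wordAt ξ j W.length →
      state σ ξ (i + (W.length - 1)) = state σ ξ (j + (W.length - 1)) := fun {i j} hi hj => by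
    obtain ⟨t, ht, hti, htj⟩ := hL i j fun s hs => hagree hi hj s (by omega)
    exact state_eq_of_common_cut hne hwm hfix (hagree hi hj) hti htj (by omega) (by omega)
  have hend : ∀ i, i + W.length = i + (W.length - 1) + 1 := fun i => by omega
  obtain ⟨r, hr, hrt⟩ := hright' true
  obtain ⟨r', hr', hrf⟩ := hright' false
  have hcut : IsCut σ ξ (r + W.length) := by
    by_contra h
    rw [hend] at h hrt hrf
    have := apply_succ_eq_of_state_eq hne hwm hfix (hsync hr hr') h
    simp [hrt, hrf] at this
  have hcut' : ∀ {i}, W = wordAt ξ i W.length → IsCut σ ξ (i + W.length) := fun {i} hi => by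
    rw [hend] at hcut ⊢
    exact (isCut_succ_iff_of_state_eq hne (hsync hr hi)).mp hcut
  obtain ⟨x, hx, hxt, hWx⟩ := hleft' true
  obtain ⟨y, hy, hyf, hWy⟩ := hleft' false
  obtain ⟨U, hU⟩ := exists_eq_T hne hW0 hfix hx hy (by simp [hxt, hyf]) W.length
    (hagree hWx hWy) (hcut' hWx) (hcut' hWy)
  rw [← hWx] at hU
  refine ⟨U, hU, fun V hV => ?_⟩
  have hV' : W = T σ W0 V := hV
  rw [hU, T, T] at hV'
  exact (subst_injective hwm (List.append_cancel_left hV')).symm
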